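/- Let A be a real matrix with row index set I of size N and column index set J of size P ≥ 1, and for 2 ≤ n ≤ N let H̄_n denote the average of the H-scores H(S,J) over all subsets S ⊆ I with |S| = n. If H̄_n > 0 for some n with 2 ≤ n ≤ N − 1, then H̄_{n+1} > H̄_n; that is, the average H-score strictly increases with the number of rows whenever it is nonzero. -/

import Mathlib

open Finset

/-- The H-score (mean squared residue) of the submatrix of `a` determined by
row subset `S` and column subset `T`. -/
noncomputable def Hscore {I J : Type*} (a : I → J → ℝ) (S : Finset I) (T : Finset J) : ℝ :=
  (1 / ((S.card : ℝ) * (T.card : ℝ))) * ∑ i ∈ S, ∑ j ∈ T,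
    (a i j - (1 / (T.card : ℝ)) * ∑ k ∈ T, a i k
           - (1 / (S.card : ℝ)) * ∑ s ∈ S, a s j
           + (1 / ((S.card : ℝ) * (T.card : ℝ))) * ∑ s ∈ S, ∑ k ∈ T, a s k) ^ 2

/-- The average H-score of all submatrices with `n` rows (and all `P` columns). -/
noncomputable def HbarRow (N P : ℕ) (a : Fin N → Fin P → ℝ) (n : ℕ) : ℝ :=
  ((N.choose n : ℝ))⁻¹ *
    ∑ S ∈ Finset.powersetCard n (Finset.univ : Finset (Fin N)),
      Hscore a S Finset.univ

theorem hb_count {N : ℕ} (n : ℕ) (i k : Fin N) (h : i ≠ k) :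
    ((Finset.powersetCard (n+2) (Finset.univ : Finset (Fin N))).filter
      (fun S => i ∈ S ∧ k ∈ S)).card = (N - 2).choose n := by
  have hc : (({i, k} : Finset (Fin N))ᶜ).card = N - 2 := by
    rw [Finset.card_compl, Finset.card_pair h, Fintype.card_fin]
  rw [← hc, ← Finset.card_powersetCard]
  refine Finset.card_bij' (fun S _ => S \ {i, k}) (fun S _ => S ∪ {i, k}) ?_ ?_ ?_ ?_
  · intro S hS
    simp only [mem_filter, mem_powersetCard, subset_univ, true_and] at hS
    obtain ⟨h1, h2, h3⟩ := hS
    have hsub : ({i, k} : Finset (Fin N)) ⊆ S := by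
      intro x hx
      simp only [mem_insert, mem_singleton] at hx
      rcases hx with rfl | rfl <;> assumption
    rw [mem_powersetCard]
    refine ⟨?_, ?_⟩
    · intro x hx
      simp only [mem_sdiff] at hx
      exact mem_compl.2 hx.2
    · rw [Finset.card_sdiff_of_subset hsub, Finset.card_pair h, h1]
      omega
  · intro S hS
    rw [mem_powersetCard] at hS
    have hd : Disjoint S {i, k} := by
      rw [Finset.disjoint_left]
      intro x hx
      exact mem_compl.1 (hS.1 hx)
    simp only [mem_filter, mem_powersetCard, subset_univ, true_and]
    refine ⟨?_, by simp, by simp⟩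
    rw [Finset.card_union_of_disjoint hd, hS.2, Finset.card_pair h]
  · intro S hS
    simp only [mem_filter, mem_powersetCard, subset_univ, true_and] at hS
    obtain ⟨h1, h2, h3⟩ := hS
    apply Finset.sdiff_union_of_subset
    intro x hx
    simp only [mem_insert, mem_singleton] at hx
    rcases hx with rfl | rfl <;> assumption
  · intro S hS
    rw [mem_powersetCard] at hS
    have hd : Disjoint S {i, k} := by
      rw [Finset.disjoint_left]
      intro x hx
      exact mem_compl.1 (hS.1 hx)
    exact Finset.union_sdiff_cancel_right hd

theorem hb_sum {N : ℕ} (n : ℕ) (d : Fin N → Fin N → ℝ) (hd : ∀ i, d i i = 0) :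
    ∑ S ∈ Finset.powersetCard (n+2) (Finset.univ : Finset (Fin N)), ∑ i ∈ S, ∑ k ∈ S, d i k
      = ((N - 2).choose n : ℝ) * ∑ i, ∑ k, d i k := by
  have h1 : ∀ S : Finset (Fin N), ∑ i ∈ S, ∑ k ∈ S, d i k
      = ∑ i, ∑ k, if (i ∈ S ∧ k ∈ S) then d i k else 0 := by
    intro S
    simp [ite_and]
  rw [Finset.sum_congr rfl fun S _ => h1 S]
  rw [Finset.sum_comm, Finset.mul_sum]
  refine Finset.sum_congr rfl fun i _ => ?_
  rw [Finset.sum_comm, Finset.mul_sum]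
  refine Finset.sum_congr rfl fun k _ => ?_
  rw [← Finset.sum_filter, Finset.sum_const, nsmul_eq_mul]
  by_cases h : i = k
  · subst h; simp [hd]
  · rw [hb_count n i k h]

theorem hb_var {I : Type*} (S : Finset I) (hS : (S.card : ℝ) ≠ 0) (b : I → ℝ) :
    ∑ i ∈ S, (b i - (1 / (S.card : ℝ)) * ∑ s ∈ S, b s) ^ 2
      = (1 / (2 * (S.card : ℝ))) * ∑ i ∈ S, ∑ k ∈ S, (b i - b k) ^ 2 := by
  simp only [sub_sq, Finset.sum_add_distrib, Finset.sum_sub_distrib, Finset.sum_const,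
    nsmul_eq_mul, ← Finset.mul_sum, ← Finset.sum_mul]
  field_simp
  ring

/-- The centred pairwise row distance. -/
noncomputable def hbD {N P : ℕ} (a : Fin N → Fin P → ℝ) (i k : Fin N) : ℝ :=
  ∑ j, ((a i j - (1 / (P : ℝ)) * ∑ l, a i l) - (a k j - (1 / (P : ℝ)) * ∑ l, a k l)) ^ 2

theorem hb_score {N P : ℕ} (a : Fin N → Fin P → ℝ) (S : Finset (Fin N))
    (hS : (S.card : ℝ) ≠ 0) (hP : (P : ℝ) ≠ 0) :
    Hscore a S Finset.univ
      = (1 / (2 * (S.card : ℝ) ^ 2 * P)) * ∑ i ∈ S, ∑ k ∈ S, hbD a i k := by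
  have h2 : ∑ i ∈ S, ∑ k ∈ S, hbD a i k = ∑ j, ∑ i ∈ S, ∑ k ∈ S,
      ((a i j - (1 / (P : ℝ)) * ∑ l, a i l) - (a k j - (1 / (P : ℝ)) * ∑ l, a k l)) ^ 2 := by
    unfold hbD
    symm
    rw [Finset.sum_comm]
    refine Finset.sum_congr rfl fun i _ => ?_
    rw [Finset.sum_comm]
  have h3 := fun j : Fin P => hb_var S hS (fun i => a i j - (1 / (P : ℝ)) * ∑ l, a i l)
  unfold Hscore
  rw [h2, Finset.sum_comm, Finset.card_univ, Fintype.card_fin,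
    Finset.mul_sum (univ : Finset (Fin P)), Finset.mul_sum (univ : Finset (Fin P)) _ (1 / (2 * (S.card : ℝ) ^ 2 * P))]
  refine Finset.sum_congr rfl fun j _ => ?_
  have h4 : (1 / (2 * (S.card : ℝ) ^ 2 * P)) = (1 / ((S.card : ℝ) * P)) * (1 / (2 * (S.card : ℝ))) := by
    field_simp
  rw [h4, mul_assoc, ← h3 j]
  congr 1
  refine Finset.sum_congr rfl fun i _ => ?_
  congr 1
  rw [Finset.sum_sub_distrib, ← Finset.mul_sum]
  field_simp
  ring

theorem hb_formula (M P m : ℕ) (hP : 1 ≤ P) (hm : m ≤ M) (a : Fin (M+2) → Fin P → ℝ) :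
    HbarRow (M+2) P a (m+2) = (1 - 1 / ((m : ℝ) + 2)) *
      ((∑ i, ∑ k, hbD a i k) / (2 * P * (M+2) * (M+1))) := by
  have hP' : (P : ℝ) ≠ 0 := by positivity
  have hs : ∑ S ∈ Finset.powersetCard (m+2) (Finset.univ : Finset (Fin (M+2))),
      Hscore a S Finset.univ = (1 / (2 * ((m : ℝ) + 2) ^ 2 * P)) *
        ((M.choose m : ℝ) * ∑ i, ∑ k, hbD a i k) := by
    have := hb_sum m (hbD a) (by intro i; simp [hbD])
    rw [Nat.add_sub_cancel] at this
    rw [← this, Finset.mul_sum]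
    refine Finset.sum_congr rfl fun S hS => ?_
    have hc : (S.card : ℝ) = (m : ℝ) + 2 := by
      rw [(mem_powersetCard.1 hS).2]; push_cast; ring
    rw [hb_score a S (by rw [hc]; positivity) hP', hc]
  have e1 : ((M : ℝ) + 1) * M.choose m = (M+1).choose (m+1) * ((m : ℝ) + 1) := by
    exact_mod_cast Nat.add_one_mul_choose_eq M m
  have e2 : ((M : ℝ) + 2) * (M+1).choose (m+1) = (M+2).choose (m+2) * ((m : ℝ) + 2) := by
    exact_mod_cast Nat.add_one_mul_choose_eq (M+1) (m+1)
  have hpos : ((M+2).choose (m+2) : ℝ) ≠ 0 := by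
    have := Nat.choose_pos (show m+2 ≤ M+2 by omega)
    positivity
  have e3 : (M.choose m : ℝ) = (M+2).choose (m+2) * ((m : ℝ) + 2) * (m+1) / ((M+2) * (M+1)) := by
    rw [eq_div_iff (by positivity)]
    linear_combination ((M : ℝ) + 2) * e1 + ((m : ℝ) + 1) * e2
  unfold HbarRow
  rw [hs, e3]
  generalize ∑ i, ∑ k, hbD a i k = D
  have : (m : ℝ) + 2 ≠ 0 := by positivity
  field_simp
  ring

/-- The bias of the H-score: whenever the average H-score at row size `n` is
nonzero, it strictly increases with the number of rows. -/
theorem hbar_row_strict_mono (N P : ℕ) (hP : 1 ≤ P) (a : Fin N → Fin P → ℝ)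
    (n : ℕ) (hn : 2 ≤ n) (hnN : n + 1 ≤ N) (hpos : 0 < HbarRow N P a n) :
    HbarRow N P a n < HbarRow N P a (n + 1) := by
  obtain ⟨m, rfl⟩ : ∃ m, n = m + 2 := ⟨n - 2, by omega⟩
  obtain ⟨M, rfl⟩ : ∃ M, N = M + 2 := ⟨N - 2, by omega⟩
  have h1 := hb_formula M P m hP (by omega) a
  have h2 := hb_formula M P (m+1) hP (by omega) a
  rw [show m + 1 + 2 = m + 2 + 1 by ring] at h2
  rw [h1] at hpos
  rw [h1, h2]
  have hq : (1 : ℝ) / ((m : ℝ) + 2) ≤ 1 := by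
    rw [div_le_one (by positivity)]
    have : (0 : ℝ) ≤ m := by positivity
    linarith
  have hE := pos_of_mul_pos_right hpos (by linarith)
  refine mul_lt_mul_of_pos_right ?_ hE
  have : (1 : ℝ) / (((m + 1 : ℕ) : ℝ) + 2) < 1 / ((m : ℝ) + 2) := by
    apply one_div_lt_one_div_of_lt (by positivity)
    push_cast
    linarith
  linarith
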